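/- arXiv:1512.02950 — 2 statements merged into one kernel-verified Lean document; each statement's English description precedes it below -/
import Mathlib

section
/- Existence of cubes with small boundary for two measures. Let $d \ge 1$. Cubes in $\mathbb{R}^d$ are closed, of positive side length, and have sides parallel to the coordinate axes. For a cube $Q$, let $\ell(Q)$ be its side length and, for $a>0$, let $aQ$ be the concentric cube with side length $a\,\ell(Q)$. Given $t>0$ and a Radon measure $\mu$ on $\mathbb{R}^d$, the cube $Q$ is said to have $t$-small boundary with respect to $\mu$ if $$\mu\big(\{x \in 5Q : \operatorname{dist}(x,\partial Q) \le \lambda\,\ell(Q)\}\big) \le t\,\lambda\,\mu(5Q) \qquad \text{for every } \lambda>0,$$ where $\operatorname{dist}$ is the Euclidean distance. There is a constant $t_0 = t_0(d) > 0$, depending only on $d$, such that for every $t \ge t_0$, all Radon measures $\mu_1, \mu_2$ on $\mathbb{R}^d$ and every cube $Q \subset \mathbb{R}^d$, there is a cube $Q'$ concentric with $Q$ with $Q \subset Q' \subset 1.1Q$ which has $t$-small boundary with respect to both $\mu_1$ and $\mu_2$. -/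
open MeasureTheory

noncomputable section

/-- A closed, non-degenerate cube in `ℝ^d` with sides parallel to the coordinate axes,
given by its center and its side length. -/
structure Cube (d : ℕ) where
  center : EuclideanSpace ℝ (Fin d)
  side : ℝ
  side_pos : 0 < side

/-- The set of points of the cube. -/
def Cube.toSet {d : ℕ} (Q : Cube d) : Set (EuclideanSpace ℝ (Fin d)) :=
  {x | ∀ i, |x i - Q.center i| ≤ Q.side / 2}

/-- The cube `aQ`, concentric with `Q` and with `a` times its side length
(equivalently, `a` times its diameter). -/
def Cube.scale {d : ℕ} (a : ℝ) (ha : 0 < a) (Q : Cube d) : Cube d :=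
  ⟨Q.center, a * Q.side, mul_pos ha Q.side_pos⟩

/-- `Q` has `t`-small boundary with respect to `μ`. The distance to `∂Q` is the Euclidean one,
taken in `[0, ∞]`, so that the distance to the empty set is `∞`. -/
def Cube.HasSmallBoundary {d : ℕ} (Q : Cube d) (t : ℝ)
    (μ : Measure (EuclideanSpace ℝ (Fin d))) : Prop :=
  ∀ lam : ℝ, 0 < lam →
    μ {x ∈ (Q.scale 5 (by norm_num)).toSet |
        Metric.infEDist x (frontier Q.toSet) ≤ ENNReal.ofReal (lam * Q.side)}
      ≤ ENNReal.ofReal (t * lam) * μ (Q.scale 5 (by norm_num)).toSet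

end

/-- The points `u` of the line that are the center of an interval of radius `r ≤ R` with
`ν`-measure greater than `K * r * ν univ`. -/
def superlevelPoints (ν : Measure ℝ) (K R : ℝ) : Set ℝ :=
  {u | ∃ r : ℝ, 0 < r ∧ r ≤ R ∧
    ENNReal.ofReal (K * r) * ν Set.univ < ν (Metric.closedBall u r)}

theorem measure_closedBall_le_of_notMem_superlevelPoints {ν : Measure ℝ} {K R u r : ℝ}
    (hu : u ∉ superlevelPoints ν K R) (hr : 0 < r) (hrR : r ≤ R) :
    ν (Metric.closedBall u r) ≤ ENNReal.ofReal (K * r) * ν Set.univ :=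
  not_lt.1 fun h => hu ⟨r, hr, hrR, h⟩

/-- Weak type `(1, 1)` estimate on the line for the maximal function of a finite measure, with
radii bounded by `R`. -/
theorem volume_superlevelPoints_le (ν : Measure ℝ) [IsFiniteMeasure ν]
    {K : ℝ} (hK : 0 < K) (R : ℝ) :
    volume (superlevelPoints ν K R) ≤ ENNReal.ofReal (10 / K) := by
  set B := superlevelPoints ν K R
  have hBr : ∀ u : ℝ, ∃ r : ℝ, u ∈ B → 0 < r ∧ r ≤ R ∧
      ENNReal.ofReal (K * r) * ν Set.univ < ν (Metric.closedBall u r) := by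
    intro u
    by_cases hu : u ∈ B
    · obtain ⟨r, hr⟩ := hu
      exact ⟨r, fun _ => hr⟩
    · exact ⟨0, fun h => absurd h hu⟩
  choose r hr using hBr
  obtain ⟨v, hvB, hdisj, hcov⟩ :=
    Vitali.exists_disjoint_subfamily_covering_enlargement_closedBall B (fun u => u) r R
      (fun u hu => (hr u hu).2.1) 5 (by norm_num)
  have hvc : v.Countable := by
    refine hdisj.countable_of_nonempty_interior fun u hu => ?_
    exact ⟨u, Metric.ball_subset_interior_closedBall
      (Metric.mem_ball_self (hr u (hvB hu)).1)⟩
  have hsub : B ⊆ ⋃ u ∈ v, Metric.closedBall u (5 * r u) := by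
    intro u hu
    obtain ⟨w, hw, h⟩ := hcov u hu
    exact Set.mem_biUnion hw (h (Metric.mem_closedBall_self (hr u hu).1.le))
  have hpack : ∑' u : v, ν (Metric.closedBall (u : ℝ) (r u)) ≤ ν Set.univ := by
    rw [← measure_biUnion hvc hdisj fun u _ => Metric.isClosed_closedBall.measurableSet]
    exact measure_mono (Set.subset_univ _)
  rcases eq_or_ne (ν Set.univ) 0 with h0 | h0
  · have : B = ∅ := by
      refine Set.eq_empty_of_forall_notMem fun u hu => ?_
      have h := (hr u hu).2.2
      rw [h0, mul_zero, Measure.measure_univ_eq_zero.1 h0] at h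
      simp at h
    simp [this]
  have hsum : (∑' u : v, ENNReal.ofReal (K * r u)) ≤ 1 := by
    refine (ENNReal.mul_le_mul_iff_left h0 (measure_ne_top ν _)).1 ?_
    rw [← ENNReal.tsum_mul_right, one_mul]
    exact (ENNReal.tsum_le_tsum fun u : v => (hr u (hvB u.2)).2.2.le).trans hpack
  calc volume B ≤ volume (⋃ u ∈ v, Metric.closedBall u (5 * r u)) := measure_mono hsub
    _ ≤ ∑' u : v, volume (Metric.closedBall (u : ℝ) (5 * r u)) := measure_biUnion_le _ hvc _
    _ = ∑' u : v, ENNReal.ofReal (10 / K) * ENNReal.ofReal (K * r u) := by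
      refine tsum_congr fun u => ?_
      rw [Real.volume_closedBall, ← ENNReal.ofReal_mul (by positivity)]
      congr 1
      field_simp
      ring
    _ = ENNReal.ofReal (10 / K) * ∑' u : v, ENNReal.ofReal (K * r u) := ENNReal.tsum_mul_left
    _ ≤ ENNReal.ofReal (10 / K) * 1 := by gcongr
    _ = ENNReal.ofReal (10 / K) := mul_one _

namespace Cube

variable {d : ℕ}

/-- The sup-norm distance from `x` to the point `c`. -/
noncomputable def supDist (c x : EuclideanSpace ℝ (Fin d)) : ℝ :=
  ‖WithLp.ofLp x - WithLp.ofLp c‖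

theorem mem_toSet_iff (Q : Cube d) (x : EuclideanSpace ℝ (Fin d)) :
    x ∈ Q.toSet ↔ supDist Q.center x ≤ Q.side / 2 := by
  rw [supDist, pi_norm_le_iff_of_nonneg (half_pos Q.side_pos).le]
  simp [toSet, Real.norm_eq_abs]

theorem continuous_supDist (c : EuclideanSpace ℝ (Fin d)) : Continuous (supDist c) := by
  unfold supDist
  fun_prop

theorem abs_supDist_sub_le_dist (c x y : EuclideanSpace ℝ (Fin d)) :
    |supDist c x - supDist c y| ≤ dist x y := by
  refine (abs_norm_sub_norm_le _ _).trans ?_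
  rw [sub_sub_sub_cancel_right, dist_eq_norm, pi_norm_le_iff_of_nonneg (norm_nonneg _)]
  exact fun i => PiLp.norm_apply_le (x - y) i

theorem frontier_toSet_subset (Q : Cube d) :
    frontier Q.toSet ⊆ {x | supDist Q.center x = Q.side / 2} := by
  have : Q.toSet = {x | supDist Q.center x ≤ Q.side / 2} := Set.ext Q.mem_toSet_iff
  rw [this]
  exact frontier_le_subset_eq (continuous_supDist _) continuous_const

theorem isCompact_toSet (Q : Cube d) : IsCompact Q.toSet := by
  have : Q.toSet = WithLp.ofLp ⁻¹' Metric.closedBall (WithLp.ofLp Q.center) (Q.side / 2) := by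
    ext x
    rw [mem_toSet_iff, Set.mem_preimage, mem_closedBall_iff_norm, supDist]
  rw [this]
  exact (PiLp.homeomorph 2 fun _ : Fin d => ℝ).isCompact_preimage.2 (isCompact_closedBall _ _)

theorem toSet_subset_toSet {Q Q' : Cube d} (hc : Q.center = Q'.center)
    (hs : Q.side ≤ Q'.side) : Q.toSet ⊆ Q'.toSet := by
  intro x hx
  rw [mem_toSet_iff] at hx ⊢
  rw [← hc]
  linarith

theorem abs_supDist_sub_le_of_infEDist_le (Q : Cube d) {x : EuclideanSpace ℝ (Fin d)} {b : ℝ}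
    (hb : 0 ≤ b) (h : Metric.infEDist x (frontier Q.toSet) ≤ ENNReal.ofReal b) :
    |supDist Q.center x - Q.side / 2| ≤ b := by
  rw [← ENNReal.ofReal_le_ofReal_iff hb]
  refine le_trans (Metric.le_infEDist.2 fun y hy => ?_) h
  rw [edist_dist, ← show _ = Q.side / 2 from Q.frontier_toSet_subset hy]
  exact ENNReal.ofReal_le_ofReal (abs_supDist_sub_le_dist _ _ _)

/-- The distribution, on the cube `5Q`, of the sup-norm distance to the center of `Q`. -/
noncomputable def radialMeasure (Q : Cube d) (μ : Measure (EuclideanSpace ℝ (Fin d))) : Measure ℝ :=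
  (μ.restrict (Q.scale 5 (by norm_num)).toSet).map (supDist Q.center)

theorem radialMeasure_univ (Q : Cube d) (μ : Measure (EuclideanSpace ℝ (Fin d))) :
    Q.radialMeasure μ Set.univ = μ (Q.scale 5 (by norm_num)).toSet := by
  rw [radialMeasure, Measure.map_apply (continuous_supDist _).measurable MeasurableSet.univ]
  simp

instance (Q : Cube d) (μ : Measure (EuclideanSpace ℝ (Fin d))) [IsLocallyFiniteMeasure μ] :
    IsFiniteMeasure (Q.radialMeasure μ) :=
  ⟨by rw [radialMeasure_univ]; exact (isCompact_toSet _).measure_lt_top⟩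

/-- A cube concentric with `Q` and of comparable size has small boundary as soon as the radial
measure is controlled on the intervals centered at half its side. -/
theorem hasSmallBoundary_of_radialMeasure_le {Q Q' : Cube d} (hc : Q'.center = Q.center)
    (h₁ : Q.side ≤ Q'.side) (h₂ : Q'.side ≤ 1.1 * Q.side)
    {μ : Measure (EuclideanSpace ℝ (Fin d))} {t : ℝ} (ht : 1 ≤ t)
    (h : ∀ r : ℝ, 0 < r → r ≤ 1.1 * Q.side →
      Q.radialMeasure μ (Metric.closedBall (Q'.side / 2) r) ≤
        ENNReal.ofReal (t / (1.1 * Q.side) * r) * Q.radialMeasure μ Set.univ) :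
    Q'.HasSmallBoundary t μ := by
  intro lam hlam
  have hQ := Q.side_pos
  have hQ' := Q'.side_pos
  rcases le_or_gt 1 lam with h1 | h1
  · refine (measure_mono (Set.sep_subset _ _)).trans (le_mul_of_one_le_left' ?_)
    rw [ENNReal.one_le_ofReal]
    nlinarith
  have hr : lam * Q'.side ≤ Q'.side := by nlinarith
  have hsub : {x ∈ (Q'.scale 5 (by norm_num)).toSet |
      Metric.infEDist x (frontier Q'.toSet) ≤ ENNReal.ofReal (lam * Q'.side)} ⊆
      supDist Q.center ⁻¹' Metric.closedBall (Q'.side / 2) (lam * Q'.side) ∩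
        (Q.scale 5 (by norm_num)).toSet := by
    rintro x ⟨-, hx⟩
    have hx' := Q'.abs_supDist_sub_le_of_infEDist_le (by positivity) hx
    rw [hc] at hx'
    refine ⟨by rwa [Set.mem_preimage, Metric.mem_closedBall, Real.dist_eq], ?_⟩
    rw [mem_toSet_iff]
    have := (abs_le.1 hx').2
    change supDist Q.center x ≤ 5 * Q.side / 2
    linarith
  calc _ ≤ _ := measure_mono hsub
    _ = Q.radialMeasure μ (Metric.closedBall (Q'.side / 2) (lam * Q'.side)) := by
      have hm := (continuous_supDist Q.center).measurable
        (Metric.isClosed_closedBall (x := Q'.side / 2) (ε := lam * Q'.side)).measurableSet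
      rw [radialMeasure, Measure.map_apply (continuous_supDist _).measurable
        Metric.isClosed_closedBall.measurableSet, Measure.restrict_apply hm]
    _ ≤ _ := h _ (by positivity) (by linarith)
    _ ≤ _ := by
      rw [radialMeasure_univ]
      refine mul_le_mul' (ENNReal.ofReal_le_ofReal ?_) (measure_mono ?_)
      · rw [div_mul_eq_mul_div, div_le_iff₀ (by positivity)]
        have : 0 ≤ t * lam := by positivity
        nlinarith
      · exact toSet_subset_toSet hc.symm (mul_le_mul_of_nonneg_left h₁ (by norm_num))

end Cube

theorem exists_small_boundary_cube_two_measures (d : ℕ) :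
    ∃ t₀ : ℝ, 0 < t₀ ∧ ∀ t : ℝ, t₀ ≤ t →
      ∀ (μ₁ μ₂ : Measure (EuclideanSpace ℝ (Fin d)))
        [IsLocallyFiniteMeasure μ₁] [IsLocallyFiniteMeasure μ₂] (Q : Cube d),
        ∃ Q' : Cube d, Q'.center = Q.center ∧
          Q.toSet ⊆ Q'.toSet ∧ Q'.toSet ⊆ (Q.scale 1.1 (by norm_num)).toSet ∧
          Q'.HasSmallBoundary t μ₁ ∧ Q'.HasSmallBoundary t μ₂ := by
  refine ⟨1000, by norm_num, fun t ht μ₁ μ₂ _ _ Q => ?_⟩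
  have hQ := Q.side_pos
  have ht0 : 0 < t := by linarith
  have hK : 0 < t / (1.1 * Q.side) := by positivity
  have hbad₁ := volume_superlevelPoints_le (Q.radialMeasure μ₁) hK (1.1 * Q.side)
  have hbad₂ := volume_superlevelPoints_le (Q.radialMeasure μ₂) hK (1.1 * Q.side)
  obtain ⟨u, hu, hgood⟩ : ∃ u ∈ Set.Icc (Q.side / 2) (1.1 * Q.side / 2),
      u ∉ superlevelPoints (Q.radialMeasure μ₁) (t / (1.1 * Q.side)) (1.1 * Q.side) ∪
        superlevelPoints (Q.radialMeasure μ₂) (t / (1.1 * Q.side)) (1.1 * Q.side) := by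
    refine Set.not_subset.1 fun hsub => ?_
    have hle := (measure_mono hsub).trans
      ((measure_union_le _ _).trans (add_le_add hbad₁ hbad₂))
    rw [Real.volume_Icc, ← ENNReal.ofReal_add (by positivity) (by positivity),
      ENNReal.ofReal_le_ofReal_iff (by positivity)] at hle
    have : 10 / (t / (1.1 * Q.side)) ≤ 0.011 * Q.side := by
      rw [div_div_eq_mul_div, div_le_iff₀ ht0]
      nlinarith
    linarith
  rw [Set.mem_union, not_or] at hgood
  obtain ⟨hu₁, hu₂⟩ := hu
  have h₁ : Q.side ≤ 2 * u := by linarith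
  have h₂ : 2 * u ≤ 1.1 * Q.side := by linarith
  have hmid : 2 * u / 2 = u := by ring
  let Q' : Cube d := ⟨Q.center, 2 * u, by linarith⟩
  have hsmall : ∀ μ : Measure (EuclideanSpace ℝ (Fin d)),
      u ∉ superlevelPoints (Q.radialMeasure μ) (t / (1.1 * Q.side)) (1.1 * Q.side) →
      Q'.HasSmallBoundary t μ := by
    intro μ hμ
    refine Cube.hasSmallBoundary_of_radialMeasure_le (Q := Q) (Q' := Q') rfl h₁ h₂ (by linarith) ?_
    intro r hr hrR
    change Q.radialMeasure μ (Metric.closedBall (2 * u / 2) r) ≤ _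
    rw [hmid]
    exact measure_closedBall_le_of_notMem_superlevelPoints hμ hr hrR
  exact ⟨Q', rfl, Cube.toSet_subset_toSet rfl h₁, Cube.toSet_subset_toSet rfl h₂,
    hsmall μ₁ hgood.1, hsmall μ₂ hgood.2⟩
end

section
/- Truncation comparison at the first doubling scale. Let $d\ge 1$, let $\mu$ be a Radon measure on $\mathbb{R}^d$ of degree $n\in(0,d]$ with constant $C_0$, i.e. $\mu(B(x,r))\le C_0r^n$ for all $x\in\mathbb{R}^d$ and $r>0$, and let $K$ be an $n$-dimensional Calderón–Zygmund kernel with constant $C$, i.e. $K$ is a complex function defined off the diagonal of $\mathbb{R}^d\times\mathbb{R}^d$ and for some $\alpha\in(0,1]$ one has $|K(x,y)|\le C|x-y|^{-n}$ for $x\neq y$, $|K(x,y)-K(x',y)|\le C|x-x'|^{\alpha}|x-y|^{-n-\alpha}$ for $x\ne y$, $|x-y|\ge 2|x-x'|$, and $|K(x,y)-K(x,y')|\le C|y-y'|^{\alpha}|x-y|^{-n-\alpha}$ for $x\ne y$, $|x-y|\ge 2|y-y'|$. For $f\in L^1_{\mathrm{loc}}(\mu)$ and $\epsilon>0$ put $T_{\mu,\epsilon}f(x)=\int_{|x-y|>\epsilon}K(x,y)f(y)\,d\mu(y)$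 and $M_\mu f(x)=\sup_{r>0}\frac{1}{\mu(B(x,r))}\int_{B(x,r)}|f|\,d\mu\in[0,\infty]$. Let $C_d>1$ and $b>(10C_d)^n$. Then for every $x\in\operatorname{supp}\mu$ and $\epsilon_0>0$ there exists a smallest integer $m\ge0$ such that $$\mu(B(x,5C_d2^m\epsilon_0))\le b\,\mu(B(x,2^m\epsilon_0)),$$ and, setting $\epsilon=2^m\epsilon_0$, one has for every $f\in L^1_{\mathrm{loc}}(\mu)$ $$|T_{\mu,\epsilon_0}f(x)-T_{\mu,\epsilon}f(x)|\le C'M_\mu f(x),$$ where $C'$ depends only on $C$, $b$, $n$, $d$ and $C_0$. Here, if the integrals defining the two truncations are not absolutely convergent, the difference is understood as $\int_{\epsilon_0<|x-y|\le\epsilon}K(x,y)f(y)\,d\mu(y)$, which always converges absolutely. -/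
open MeasureTheory Metric Set
open scoped ENNReal

noncomputable section

/-- `ℝ^d` with its Euclidean norm. -/
abbrev Pt (d : ℕ) := EuclideanSpace ℝ (Fin d)

/-- The Borel measure `μ` on `ℝ^d` is of degree `n` with constant `C₀`. Such a measure is finite on
bounded sets, hence it is automatically a Radon measure. -/
def HasDegree {d : ℕ} (μ : Measure (Pt d)) (n C₀ : ℝ) : Prop :=
  ∀ (x : Pt d) (r : ℝ), 0 < r → μ (ball x r) ≤ ENNReal.ofReal (C₀ * r ^ n)

/-- `K` is an `n`-dimensional Calderón–Zygmund kernel with constant `C` and smoothness exponent `α`.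
The values of `K` on the diagonal play no role. -/
structure IsCZKernel {d : ℕ} (K : Pt d → Pt d → ℂ) (n C α : ℝ) : Prop where
  size : ∀ x y : Pt d, x ≠ y → ‖K x y‖ ≤ C / dist x y ^ n
  smooth_fst : ∀ x x' y : Pt d, x ≠ y → 2 * dist x x' ≤ dist x y →
    ‖K x y - K x' y‖ ≤ C * dist x x' ^ α / dist x y ^ (n + α)
  smooth_snd : ∀ x y y' : Pt d, x ≠ y → 2 * dist y y' ≤ dist x y →
    ‖K x y - K x y'‖ ≤ C * dist y y' ^ α / dist x y ^ (n + α)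

/-- The truncated operator `T_{μ,ε} f(x)`. -/
def truncT {d : ℕ} (μ : Measure (Pt d)) (K : Pt d → Pt d → ℂ) (ε : ℝ) (f : Pt d → ℂ)
    (x : Pt d) : ℂ :=
  ∫ y in {y | ε < dist x y}, K x y * f y ∂μ

/-- The centred maximal function `M_μ f(x)` with respect to balls, with values in `[0,∞]`. -/
def ballMax {d : ℕ} (μ : Measure (Pt d)) (f : Pt d → ℂ) (x : Pt d) : ℝ≥0∞ :=
  ⨆ (r : ℝ) (_ : 0 < r), (∫⁻ y in ball x r, ‖f y‖ₑ ∂μ) / μ (ball x r)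

/-- The ball `B(x,r)` is `(a,b)`-doubling for `μ`: `μ(B(x, a r)) ≤ b μ(B(x, r))`. -/
def IsDoublingBall {d : ℕ} (μ : Measure (Pt d)) (a b : ℝ) (x : Pt d) (r : ℝ) : Prop :=
  μ (ball x (a * r)) ≤ ENNReal.ofReal b * μ (ball x r)

end

/-- The `n`-dimensional density `μ(B(x,r)) / r^n`. -/
noncomputable def ballDensity {d : ℕ} (μ : Measure (Pt d)) (n : ℝ) (x : Pt d) (r : ℝ) : ℝ :=
  μ.real (ball x r) / r ^ n

theorem sum_range_shift_le {θ : ℕ → ℝ} {c : ℝ} (h0 : ∀ k, 0 ≤ θ k) (hc : ∀ k, θ k ≤ c)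
    (N m : ℕ) :
    ∑ k ∈ Finset.range m, θ (k + N) ≤ ∑ k ∈ Finset.range m, θ k + N * c := by
  have h1 := Finset.sum_range_add θ N m
  have h2 := Finset.sum_range_add θ m N
  rw [Nat.add_comm m N, h1] at h2
  have h3 : ∑ k ∈ Finset.range N, θ (m + k) ≤ N * c := by
    simpa using Finset.sum_le_card_nsmul (Finset.range N) (fun k => θ (m + k)) c
      fun k _ => hc _
  have h4 : 0 ≤ ∑ k ∈ Finset.range N, θ k := Finset.sum_nonneg fun k _ => h0 k
  simp only [Nat.add_comm _ N]
  linarith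

theorem sum_range_le_of_le_mul_shift {θ : ℕ → ℝ} {c q : ℝ} (h0 : ∀ k, 0 ≤ θ k)
    (hc : ∀ k, θ k ≤ c) (hq0 : 0 ≤ q) (hq1 : q < 1) {N m : ℕ}
    (h : ∀ k < m, θ k ≤ q * θ (k + N)) :
    ∑ k ∈ Finset.range m, θ k ≤ q * (N * c) / (1 - q) := by
  have h1 : ∑ k ∈ Finset.range m, θ k ≤ q * ∑ k ∈ Finset.range m, θ (k + N) := by
    rw [Finset.mul_sum]
    exact Finset.sum_le_sum fun k hk => h k (Finset.mem_range.1 hk)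
  have h2 := mul_le_mul_of_nonneg_left (sum_range_shift_le h0 hc N m) hq0
  rw [le_div_iff₀ (by linarith)]
  linarith

theorem nonpos_of_le_mul_shift {θ : ℕ → ℝ} {c q : ℝ} (hc : ∀ k, θ k ≤ c) (hq0 : 0 ≤ q)
    (hq1 : q < 1) {N : ℕ} (h : ∀ k, θ k ≤ q * θ (k + N)) : θ 0 ≤ 0 := by
  have h1 : ∀ j : ℕ, θ 0 ≤ q ^ j * θ (j * N) := by
    intro j
    induction j with
    | zero => simp
    | succ j ih =>
      refine ih.trans ?_
      rw [pow_succ, mul_assoc, Nat.succ_mul]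
      exact mul_le_mul_of_nonneg_left (h _) (pow_nonneg hq0 j)
  have h2 : Filter.Tendsto (fun j : ℕ => q ^ j * c) Filter.atTop (nhds (0 * c)) :=
    (tendsto_pow_atTop_nhds_zero_of_lt_one hq0 hq1).mul_const c
  rw [zero_mul] at h2
  exact ge_of_tendsto' h2 fun j =>
    (h1 j).trans (mul_le_mul_of_nonneg_left (hc _) (pow_nonneg hq0 j))

/-- A dyadic scale `2^N` with `b^{1/n} / 2 ≤ 2^N < b^{1/n}`. -/
theorem exists_dyadic_scale {n b : ℝ} (hn : 0 < n) (hb : 1 < b) :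
    ∃ N : ℕ, ((2 : ℝ) ^ N) ^ n < b ∧ ∀ a : ℝ, 0 ≤ a → (2 * a) ^ n < b → a ≤ 2 ^ N := by
  have hb0 : (0 : ℝ) < b := by linarith
  have hDn : (b ^ n⁻¹) ^ n = b := Real.rpow_inv_rpow hb0.le hn.ne'
  have hD : 1 < b ^ n⁻¹ := Real.one_lt_rpow hb (inv_pos.2 hn)
  obtain ⟨N, h1, h2⟩ : ∃ N : ℕ, (2 : ℝ) ^ N < b ^ n⁻¹ ∧ b ^ n⁻¹ ≤ 2 ^ (N + 1) := by
    by_contra! hcon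
    have hall : ∀ N : ℕ, (2 : ℝ) ^ N < b ^ n⁻¹ := fun N =>
      Nat.rec (by simpa using hD) (fun k ih => hcon k ih) N
    obtain ⟨M, hM⟩ := pow_unbounded_of_one_lt (b ^ n⁻¹) (one_lt_two : (1 : ℝ) < 2)
    exact hM.not_gt (hall M)
  refine ⟨N, ?_, fun a ha hab => ?_⟩
  · rw [← hDn]
    exact Real.rpow_lt_rpow (by positivity) h1 hn
  · rw [← hDn] at hab
    have := (Real.rpow_lt_rpow_iff (by positivity) (by positivity) hn).1 hab
    rw [pow_succ] at h2
    linarith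

section Degree

variable {d : ℕ} {μ : Measure (Pt d)} {n C₀ : ℝ}

theorem HasDegree.ball_lt_top (h : HasDegree μ n C₀) (x : Pt d) (r : ℝ) : μ (ball x r) < ∞ := by
  rcases le_or_gt r 0 with hr | hr
  · simp [ball_eq_empty.2 hr]
  · exact (h x r hr).trans_lt ENNReal.ofReal_lt_top

theorem ballDensity_nonneg (x : Pt d) {r : ℝ} (hr : 0 < r) : 0 ≤ ballDensity μ n x r :=
  div_nonneg measureReal_nonneg (Real.rpow_nonneg hr.le n)

theorem HasDegree.ballDensity_le (h : HasDegree μ n C₀) (x : Pt d) {r : ℝ} (hr : 0 < r) :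
    ballDensity μ n x r ≤ |C₀| := by
  rw [ballDensity, div_le_iff₀ (Real.rpow_pos_of_pos hr n)]
  refine ENNReal.toReal_le_of_le_ofReal (by positivity) ((h x r hr).trans ?_)
  gcongr
  exact le_abs_self C₀

theorem ball_measure_pos {x : Pt d} (hx : x ∈ μ.support) {r : ℝ} (hr : 0 < r) :
    0 < μ (ball x r) :=
  (Measure.mem_support_iff_forall x).1 hx _ (ball_mem_nhds x hr)

theorem HasDegree.ballDensity_pos (h : HasDegree μ n C₀) {x : Pt d} (hx : x ∈ μ.support) {r : ℝ}
    (hr : 0 < r) : 0 < ballDensity μ n x r :=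
  div_pos (ENNReal.toReal_pos (ball_measure_pos hx hr).ne' (h.ball_lt_top x r).ne)
    (Real.rpow_pos_of_pos hr n)

theorem HasDegree.ballDensity_le_of_not_isDoublingBall (h : HasDegree μ n C₀) {a b L : ℝ}
    (hb : 0 < b) (hL : 0 < L) (haL : a ≤ L) {x : Pt d} {r : ℝ} (hr : 0 < r)
    (hnd : ¬ IsDoublingBall μ a b x r) :
    ballDensity μ n x r ≤ L ^ n / b * ballDensity μ n x (L * r) := by
  rw [IsDoublingBall, not_le] at hnd
  have h1 : ENNReal.ofReal b * μ (ball x r) ≤ μ (ball x (L * r)) :=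
    hnd.le.trans (measure_mono (ball_subset_ball (by gcongr)))
  have h2 := ENNReal.toReal_mono (h.ball_lt_top x _).ne h1
  rw [ENNReal.toReal_mul, ENNReal.toReal_ofReal hb.le] at h2
  have hrn := Real.rpow_pos_of_pos hr n
  have hLn := Real.rpow_pos_of_pos hL n
  have h3 : L ^ n / b * ballDensity μ n x (L * r) = μ.real (ball x (L * r)) / b / r ^ n := by
    rw [ballDensity, Real.mul_rpow hL.le hr.le]
    field_simp
  rw [h3, ballDensity]
  gcongr
  rw [le_div_iff₀' hb]
  exact h2

theorem HasDegree.exists_isDoublingBall (h : HasDegree μ n C₀) {a b : ℝ} (hb : 0 < b) {N : ℕ}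
    (hN : ((2 : ℝ) ^ N) ^ n < b) (haN : a ≤ 2 ^ N) {x : Pt d} (hx : x ∈ μ.support) {ε₀ : ℝ}
    (hε : 0 < ε₀) : ∃ k : ℕ, IsDoublingBall μ a b x (2 ^ k * ε₀) := by
  by_contra! hcon
  refine (h.ballDensity_pos hx (r := 2 ^ 0 * ε₀) (by positivity)).not_ge ?_
  refine nonpos_of_le_mul_shift (θ := fun k => ballDensity μ n x (2 ^ k * ε₀)) (N := N)
    (fun k => h.ballDensity_le x (by positivity)) (q := ((2 : ℝ) ^ N) ^ n / b) (by positivity)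
    ((div_lt_one hb).2 hN) fun k => ?_
  have := h.ballDensity_le_of_not_isDoublingBall hb (L := 2 ^ N) (by positivity) haN
    (by positivity) (hcon k)
  rwa [← mul_assoc, ← pow_add, Nat.add_comm N k] at this

/-- Up to the first doubling scale the densities form a bounded sum. -/
theorem HasDegree.sum_ballDensity_le (h : HasDegree μ n C₀) {a b : ℝ} (hb : 0 < b) {N : ℕ}
    (hN : ((2 : ℝ) ^ N) ^ n < b) (haN : a ≤ 2 ^ N) {x : Pt d} {ε₀ : ℝ} (hε : 0 < ε₀) {m : ℕ}
    (hm : ∀ k < m, ¬ IsDoublingBall μ a b x (2 ^ k * ε₀)) :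
    ∑ k ∈ Finset.range m, ballDensity μ n x (2 ^ k * ε₀) ≤
      ((2 : ℝ) ^ N) ^ n / b * (N * |C₀|) / (1 - ((2 : ℝ) ^ N) ^ n / b) := by
  refine sum_range_le_of_le_mul_shift (θ := fun k => ballDensity μ n x (2 ^ k * ε₀)) (N := N)
    (fun k => ballDensity_nonneg x (by positivity)) (fun k => h.ballDensity_le x (by positivity))
    (by positivity) ((div_lt_one hb).2 hN) fun k hk => ?_
  have := h.ballDensity_le_of_not_isDoublingBall hb (L := 2 ^ N) (by positivity) haN
    (by positivity) (hm k hk)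
  rwa [← mul_assoc, ← pow_add, Nat.add_comm N k] at this

theorem HasDegree.lintegral_ball_le (h : HasDegree μ n C₀) {x : Pt d} (hx : x ∈ μ.support)
    (f : Pt d → ℂ) {r : ℝ} (hr : 0 < r) :
    ∫⁻ y in ball x r, ‖f y‖ₑ ∂μ ≤ ballMax μ f x * μ (ball x r) := by
  rw [← ENNReal.div_le_iff (ball_measure_pos hx hr).ne' (h.ball_lt_top x r).ne]
  exact le_iSup₂ (f := fun (r : ℝ) (_ : 0 < r) =>
    (∫⁻ y in ball x r, ‖f y‖ₑ ∂μ) / μ (ball x r)) r hr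

end Degree

section Kernel

variable {d : ℕ} {μ : Measure (Pt d)} {n C C₀ α : ℝ} {K : Pt d → Pt d → ℂ}

theorem measurableSet_annulus (x : Pt d) (r s : ℝ) :
    MeasurableSet {y | r < dist x y ∧ dist x y ≤ s} :=
  (measurableSet_lt measurable_const (measurable_const.dist measurable_id)).inter
    (measurableSet_le (measurable_const.dist measurable_id) measurable_const)

theorem IsCZKernel.continuousOn_snd (hK : IsCZKernel K n C α) (hα : 0 < α) (x : Pt d) :
    ContinuousOn (K x) {x}ᶜ := by
  intro y hy
  have hxy : x ≠ y := fun h => hy h.symm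
  have hpos : 0 < dist x y := dist_pos.2 hxy
  refine ContinuousAt.continuousWithinAt ?_
  rw [ContinuousAt, tendsto_iff_norm_sub_tendsto_zero]
  have hlim : Filter.Tendsto (fun y' => C * dist y y' ^ α / dist x y ^ (n + α)) (nhds y)
      (nhds 0) := by
    have : ContinuousAt (fun y' => C * dist y y' ^ α / dist x y ^ (n + α)) y :=
      ((continuousAt_const.mul ((continuous_const.dist continuous_id).continuousAt.rpow_const
        (Or.inr hα.le))).div_const _)
    simpa [ContinuousAt, Real.zero_rpow hα.ne'] using this
  refine squeeze_zero' (Filter.Eventually.of_forall fun _ => norm_nonneg _) ?_ hlim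
  filter_upwards [ball_mem_nhds y (half_pos hpos)] with y' hy'
  rw [norm_sub_rev]
  refine hK.smooth_snd x y y' hxy ?_
  rw [mem_ball, dist_comm] at hy'
  linarith

theorem IsCZKernel.norm_le_of_lt_dist (hK : IsCZKernel K n C α) (hn : 0 < n) {x y : Pt d} {r : ℝ}
    (hr : 0 < r) (hy : r < dist x y) : ‖K x y‖ ≤ |C| / r ^ n := by
  refine (hK.size x y (dist_pos.1 (hr.trans hy))).trans ?_
  gcongr
  exact le_abs_self C

theorem IsCZKernel.integrableOn_annulus (hK : IsCZKernel K n C α) (hn : 0 < n) (hα : 0 < α)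
    (x : Pt d) {r : ℝ} (hr : 0 < r) (s : ℝ) {f : Pt d → ℂ} (hf : LocallyIntegrable f μ) :
    IntegrableOn (fun y => K x y * f y) {y | r < dist x y ∧ dist x y ≤ s} μ := by
  have hmeas := measurableSet_annulus x r s
  have hfi : IntegrableOn f {y | r < dist x y ∧ dist x y ≤ s} μ :=
    (hf.integrableOn_isCompact (isCompact_closedBall x s)).mono_set fun y hy => by
      rw [mem_closedBall, dist_comm]
      exact hy.2
  refine Integrable.bdd_mul (c := |C| / r ^ n) hfi ?_ ?_
  · refine ((hK.continuousOn_snd hα x).mono fun y hy => ?_).aestronglyMeasurable hmeas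
    exact fun h => (hr.trans hy.1).ne' (by rw [mem_singleton_iff.1 h, dist_self])
  · exact (ae_restrict_mem hmeas).mono fun y hy => hK.norm_le_of_lt_dist hn hr hy.1

theorem IsCZKernel.lintegral_dyadic_annulus_le (hK : IsCZKernel K n C α) (hn : 0 < n)
    (hμ : HasDegree μ n C₀) {x : Pt d} (hx : x ∈ μ.support) (f : Pt d → ℂ) {r : ℝ} (hr : 0 < r) :
    ∫⁻ y in {y | r < dist x y ∧ dist x y ≤ 2 * r}, ‖K x y * f y‖ₑ ∂μ ≤
      ENNReal.ofReal (|C| * 4 ^ n * ballDensity μ n x (4 * r)) * ballMax μ f x := by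
  have hrn := Real.rpow_pos_of_pos hr n
  calc ∫⁻ y in {y | r < dist x y ∧ dist x y ≤ 2 * r}, ‖K x y * f y‖ₑ ∂μ
      ≤ ∫⁻ y in {y | r < dist x y ∧ dist x y ≤ 2 * r},
          ENNReal.ofReal (|C| / r ^ n) * ‖f y‖ₑ ∂μ := by
        refine setLIntegral_mono' (measurableSet_annulus x r _) fun y hy => ?_
        rw [enorm_mul, ← ofReal_norm (K x y)]
        gcongr
        exact hK.norm_le_of_lt_dist hn hr hy.1
    _ ≤ ∫⁻ y in ball x (4 * r), ENNReal.ofReal (|C| / r ^ n) * ‖f y‖ₑ ∂μ := by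
        refine lintegral_mono_set fun y hy => ?_
        rw [mem_ball, dist_comm]
        linarith [hy.2]
    _ = ENNReal.ofReal (|C| / r ^ n) * ∫⁻ y in ball x (4 * r), ‖f y‖ₑ ∂μ :=
        lintegral_const_mul' _ _ ENNReal.ofReal_ne_top
    _ ≤ ENNReal.ofReal (|C| / r ^ n) * (ballMax μ f x * μ (ball x (4 * r))) := by
        gcongr
        exact hμ.lintegral_ball_le hx f (by positivity)
    _ = ENNReal.ofReal (|C| * 4 ^ n * ballDensity μ n x (4 * r)) * ballMax μ f x := by
        have h1 : |C| * 4 ^ n * ballDensity μ n x (4 * r) =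
            |C| / r ^ n * μ.real (ball x (4 * r)) := by
          rw [ballDensity, Real.mul_rpow (by norm_num) hr.le]
          field_simp
        rw [h1, ENNReal.ofReal_mul (by positivity),
          ofReal_measureReal (hμ.ball_lt_top x _).ne]
        ring

theorem IsCZKernel.lintegral_annulus_le_sum (hK : IsCZKernel K n C α) (hn : 0 < n)
    (hμ : HasDegree μ n C₀) {x : Pt d} (hx : x ∈ μ.support) (f : Pt d → ℂ) {ε₀ : ℝ}
    (hε : 0 < ε₀) (m : ℕ) :
    ∫⁻ y in {y | ε₀ < dist x y ∧ dist x y ≤ 2 ^ m * ε₀}, ‖K x y * f y‖ₑ ∂μ ≤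
      ENNReal.ofReal (|C| * 4 ^ n *
        ∑ k ∈ Finset.range m, ballDensity μ n x (2 ^ (k + 2) * ε₀)) * ballMax μ f x := by
  induction m with
  | zero =>
    have : {y | ε₀ < dist x y ∧ dist x y ≤ 2 ^ 0 * ε₀} = ∅ := by
      ext y
      simp
    rw [this]
    simp
  | succ m ih =>
    have hsub : {y | ε₀ < dist x y ∧ dist x y ≤ 2 ^ (m + 1) * ε₀} ⊆
        {y | ε₀ < dist x y ∧ dist x y ≤ 2 ^ m * ε₀} ∪
        {y | 2 ^ m * ε₀ < dist x y ∧ dist x y ≤ 2 * (2 ^ m * ε₀)} := by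
      rintro y ⟨h1, h2⟩
      rcases le_or_gt (dist x y) (2 ^ m * ε₀) with h | h
      · exact Or.inl ⟨h1, h⟩
      · exact Or.inr ⟨h, h2.trans_eq (by ring)⟩
    refine (lintegral_mono_set hsub).trans ((lintegral_union_le _ _ _).trans ?_)
    refine (add_le_add ih
      (hK.lintegral_dyadic_annulus_le hn hμ hx f (r := 2 ^ m * ε₀) (by positivity))).trans_eq ?_
    have h4 : (4 : ℝ) * (2 ^ m * ε₀) = 2 ^ (m + 2) * ε₀ := by ring
    have hd : ∀ k : ℕ, 0 ≤ ballDensity μ n x (2 ^ (k + 2) * ε₀) :=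
      fun k => ballDensity_nonneg x (by positivity)
    have hc : 0 ≤ |C| * (4 : ℝ) ^ n := by positivity
    rw [h4, ← add_mul, ← ENNReal.ofReal_add
      (mul_nonneg hc (Finset.sum_nonneg fun k _ => hd k)) (mul_nonneg hc (hd m)),
      ← mul_add, ← Finset.sum_range_succ]

end Kernel

/-- The difference of two truncations is either the integral over the annulus or, when they do not
converge absolutely, zero. -/
theorem enorm_truncT_sub_le {d : ℕ} {μ : Measure (Pt d)} {K : Pt d → Pt d → ℂ} {f : Pt d → ℂ}
    {x : Pt d} {r s : ℝ} (hrs : r ≤ s)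
    (hA : IntegrableOn (fun y => K x y * f y) {y | r < dist x y ∧ dist x y ≤ s} μ) :
    ‖truncT μ K r f x - truncT μ K s f x‖ₑ ≤
      ‖∫ y in {y | r < dist x y ∧ dist x y ≤ s}, K x y * f y ∂μ‖ₑ := by
  have hunion : {y | r < dist x y} = {y | r < dist x y ∧ dist x y ≤ s} ∪ {y | s < dist x y} := by
    ext y
    simp only [mem_ofPred_eq, mem_union]
    constructor
    · intro h
      rcases le_or_gt (dist x y) s with h' | h'
      · exact Or.inl ⟨h, h'⟩
      · exact Or.inr h'
    · rintro (h | h)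
      · exact h.1
      · exact hrs.trans_lt h
  have hmeas : MeasurableSet {y | s < dist x y} :=
    measurableSet_lt measurable_const (measurable_const.dist measurable_id)
  have hdisj : Disjoint {y | r < dist x y ∧ dist x y ≤ s} {y | s < dist x y} :=
    Set.disjoint_left.2 fun y h1 h2 => h1.2.not_gt h2
  by_cases hB : IntegrableOn (fun y => K x y * f y) {y | s < dist x y} μ
  · rw [truncT, truncT, hunion, setIntegral_union hdisj hmeas hA hB, add_sub_cancel_right]
  · have hB' : ¬ IntegrableOn (fun y => K x y * f y) {y | r < dist x y} μ := fun h =>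
      hB (h.mono_set fun y hy => hrs.trans_lt hy)
    rw [truncT, truncT, integral_undef hB, integral_undef hB']
    simp

/-- Truncation comparison at the first doubling scale. The constant `C'` is chosen before the
dilation constant `Cd`, the exponent `α`, the measure, the kernel, the point and the function.
The integral of `K x y * f y` over `ε₀ < |x - y| ≤ ε` always converges absolutely; it is the
difference of the two truncations when these converge absolutely, and gives that difference a
meaning when they do not, so the bound is stated for it as well. -/
theorem truncation_comparison_first_doubling_scale
    (d : ℕ) (n C₀ C b : ℝ) (hn : 0 < n) (hnd : n ≤ d) :
    ∃ C' : ℝ, 0 < C' ∧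
      ∀ Cd : ℝ, 1 < Cd → (10 * Cd) ^ n < b →
      ∀ μ : Measure (Pt d), HasDegree μ n C₀ →
      ∀ α : ℝ, 0 < α → α ≤ 1 →
      ∀ K : Pt d → Pt d → ℂ, IsCZKernel K n C α →
      ∀ x : Pt d, x ∈ μ.support →
      ∀ ε₀ : ℝ, 0 < ε₀ →
        ∃ m : ℕ,
          IsLeast {k : ℕ | IsDoublingBall μ (5 * Cd) b x (2 ^ k * ε₀)} m ∧
          ∀ f : Pt d → ℂ, LocallyIntegrable f μ →
            IntegrableOn (fun y => K x y * f y) {y | ε₀ < dist x y ∧ dist x y ≤ 2 ^ m * ε₀} μ ∧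
            ‖∫ y in {y | ε₀ < dist x y ∧ dist x y ≤ 2 ^ m * ε₀}, K x y * f y ∂μ‖ₑ
              ≤ ENNReal.ofReal C' * ballMax μ f x ∧
            ‖truncT μ K ε₀ f x - truncT μ K (2 ^ m * ε₀) f x‖ₑ
              ≤ ENNReal.ofReal C' * ballMax μ f x := by
  by_cases hb : 1 < b
  swap
  · refine ⟨1, one_pos, fun Cd hCd hb' => absurd ?_ hb⟩
    exact (Real.one_lt_rpow (by linarith) hn).trans hb'
  have hb0 : 0 < b := one_pos.trans hb
  obtain ⟨N, hN, haN⟩ := exists_dyadic_scale hn hb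
  have hq : 0 < 1 - ((2 : ℝ) ^ N) ^ n / b := sub_pos.2 ((div_lt_one hb0).2 hN)
  set S : ℝ := ((2 : ℝ) ^ N) ^ n / b * (N * |C₀|) / (1 - ((2 : ℝ) ^ N) ^ n / b) with hS
  have hS0 : 0 ≤ S := by positivity
  refine ⟨|C| * 4 ^ n * (S + 2 * |C₀|) + 1, by positivity, ?_⟩
  intro Cd hCd hCdb μ hμ α hα _ K hK x hx ε₀ hε
  have ha : 5 * Cd ≤ 2 ^ N := haN _ (by linarith) (by convert hCdb using 2; ring)
  have hex := hμ.exists_isDoublingBall hb0 hN ha hx hε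
  classical
  have hleast : IsLeast {k : ℕ | IsDoublingBall μ (5 * Cd) b x (2 ^ k * ε₀)} (Nat.find hex) :=
    ⟨Nat.find_spec hex, fun k hk => Nat.find_min' hex hk⟩
  have hsum := hμ.sum_ballDensity_le hb0 hN ha hε fun k hk => Nat.find_min hex hk
  generalize Nat.find hex = m at hleast hsum
  refine ⟨m, hleast, fun f hf => ?_⟩
  have hint := hK.integrableOn_annulus hn hα x hε (2 ^ m * ε₀) hf
  have hshift := sum_range_shift_le (θ := fun k => ballDensity μ n x (2 ^ k * ε₀))
    (fun k => ballDensity_nonneg x (by positivity)) (fun k => hμ.ballDensity_le x (by positivity))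
    2 m
  have hbound : ‖∫ y in {y | ε₀ < dist x y ∧ dist x y ≤ 2 ^ m * ε₀}, K x y * f y ∂μ‖ₑ
      ≤ ENNReal.ofReal (|C| * 4 ^ n * (S + 2 * |C₀|) + 1) * ballMax μ f x := by
    refine (enorm_integral_le_lintegral_enorm _).trans
      ((hK.lintegral_annulus_le_sum hn hμ hx f hε m).trans ?_)
    gcongr
    refine le_add_of_le_of_nonneg ?_ zero_le_one
    gcongr
    push_cast at hshift
    linarith
  have hle : ε₀ ≤ 2 ^ m * ε₀ := le_mul_of_one_le_left hε.le (one_le_pow₀ one_le_two)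
  exact ⟨hint, hbound, (enorm_truncT_sub_le hle hint).trans hbound⟩
end
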